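/- arXiv:2207.02994 — 3 statements merged into one kernel-verified Lean document; each statement's English description precedes it below -/
import Mathlib

section
/- (Lemma 5) Let q be a prime power and L ≥ 3 an integer. There exists a linear code over F_q with disjoint local repair groups, length n = 3L, dimension k = 2L − 4, minimum distance d with 7 ≤ d ≤ 8, and locality r = 2, if and only if there exists a sequence of vectors u_1^(i), u_2^(i) ∈ F_q^4 (i = 1,…,L) satisfying conditions C.1, C.2 and C.3. -/
variable {F : Type*} [Field F] [DecidableEq F] {n : ℕ}

/-- Hamming weight of a vector. -/
def wt (c : Fin n → F) : ℕ := (Finset.univ.filter fun i => c i ≠ 0).card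

/-- The dual code of a linear code `C ⊆ F^n`. -/
def dualCode (C : Submodule F (Fin n → F)) : Submodule F (Fin n → F) where
  carrier := {y | ∀ x ∈ C, ∑ i, x i * y i = 0}
  add_mem' := by
    intro a b ha hb x hx
    simp only [Set.mem_setOf_eq] at *
    simp [Pi.add_apply, mul_add, Finset.sum_add_distrib, ha x hx, hb x hx]
  zero_mem' := by intro x hx; simp
  smul_mem' := by
    intro c y hy x hx
    simp only [Set.mem_setOf_eq] at *
    simp [Pi.smul_apply, smul_eq_mul, mul_left_comm, ← Finset.mul_sum, hy x hx]

/-- `d` is the minimum distance of the linear code `C`. -/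
def IsMinDist (C : Submodule F (Fin n → F)) (d : ℕ) : Prop :=
  (∃ c ∈ C, c ≠ 0 ∧ wt c = d) ∧ ∀ c ∈ C, c ≠ 0 → d ≤ wt c

/-- `C` is a locally repairable code with locality `r`. -/
def HasLocality (C : Submodule F (Fin n → F)) (r : ℕ) : Prop :=
  ∀ i : Fin n, ∃ c ∈ dualCode C, wt c ≤ r + 1 ∧ c i ≠ 0

/-- `C` has disjoint local repair groups of size `r+1`. -/
def HasDisjointLRG (C : Submodule F (Fin n → F)) (r : ℕ) : Prop :=
  ∃ P : Finset (Finset (Fin n)),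
    (∀ G ∈ P, G.card = r + 1) ∧
    (∀ i : Fin n, ∃! G, G ∈ P ∧ i ∈ G) ∧
    (∀ G ∈ P, ∃ c ∈ dualCode C, ∀ i, c i ≠ 0 ↔ i ∈ G)

/-- Conditions C.1, C.2 and C.3 on a sequence of vectors
`u_1^(i), u_2^(i) ∈ F_q^4`, `i = 1, …, L`, where `u_0^(i) := u_1^(i) − u_2^(i)`. -/
def GoodSeq {F : Type*} [Field F] (L : ℕ) (u₁ u₂ : Fin L → (Fin 4 → F)) : Prop :=
  -- C.1
  (∀ i : Fin L, Module.finrank F (Submodule.span F {u₁ i, u₂ i}) = 2) ∧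
  -- C.2
  (∀ i j : Fin L, i < j →
      Submodule.span F {u₁ i, u₂ i} ⊓ Submodule.span F {u₁ j, u₂ j} = ⊥) ∧
  -- C.3
  (∀ i j t : Fin L, i < j → j < t → ∀ a b c : Fin 3,
      Module.finrank F (Submodule.span F
        ({![u₁ i - u₂ i, u₁ i, u₂ i] a,
           ![u₁ j - u₂ j, u₁ j, u₂ j] b,
           ![u₁ t - u₂ t, u₁ t, u₂ t] c} : Set (Fin 4 → F))) = 3)

namespace L5

/-- local weight -/
def w {F : Type*} [Field F] [DecidableEq F] (p : F × F) : ℕ :=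
  (if p.1 ≠ 0 then 1 else 0) + (if p.2 ≠ 0 then 1 else 0) + (if p.1 + p.2 ≠ 0 then 1 else 0)

/-- total weight -/
def W {F : Type*} [Field F] [DecidableEq F] {L : ℕ} (y : Fin L → F × F) : ℕ := ∑ i, w (y i)

/-- syndrome map -/
def psi {F : Type*} [Field F] {L : ℕ} (u₁ u₂ : Fin L → (Fin 4 → F)) :
    (Fin L → F × F) →ₗ[F] (Fin 4 → F) where
  toFun y := ∑ i, ((y i).1 • u₁ i + (y i).2 • u₂ i)
  map_add' x y := by
    rw [← Finset.sum_add_distrib]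
    refine Finset.sum_congr rfl fun i _ => ?_
    simp only [Pi.add_apply, Prod.fst_add, Prod.snd_add]
    module
  map_smul' a y := by
    rw [RingHom.id_apply, Finset.smul_sum]
    refine Finset.sum_congr rfl fun i _ => ?_
    simp only [Pi.smul_apply, Prod.smul_fst, Prod.smul_snd, smul_eq_mul]
    module

theorem w_zero {F : Type*} [Field F] [DecidableEq F] : w (0 : F × F) = 0 := by simp [w]

theorem w_le {F : Type*} [Field F] [DecidableEq F] (p : F × F) : w p ≤ 3 := by
  unfold w; split_ifs <;> simp

theorem w_ge {F : Type*} [Field F] [DecidableEq F] (p : F × F) (h : p ≠ 0) : 2 ≤ w p := by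
  obtain ⟨a, b⟩ := p
  unfold w
  by_cases ha : a = 0 <;> by_cases hb : b = 0 <;> simp_all

theorem w_add {F : Type*} [Field F] [DecidableEq F] (p q : F × F) : w (p + q) ≤ w p + w q := by
  have key : ∀ a b : F, (if a + b ≠ 0 then 1 else 0) ≤
      (if a ≠ 0 then 1 else 0) + (if b ≠ 0 then 1 else 0) := by
    intro a b
    by_cases ha : a = 0 <;> by_cases hb : b = 0 <;> simp_all
    split_ifs <;> simp
  unfold w
  have h1 := key p.1 q.1
  have h2 := key p.2 q.2
  have h3 := key (p.1 + p.2) (q.1 + q.2)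
  rw [show p.1 + p.2 + (q.1 + q.2) = (p + q).1 + (p + q).2 by
    simp only [Prod.fst_add, Prod.snd_add]; ring] at h3
  simp only [Prod.fst_add, Prod.snd_add] at *
  omega

theorem W_add {F : Type*} [Field F] [DecidableEq F] {L : ℕ} (x y : Fin L → F × F) :
    W (x + y) ≤ W x + W y := by
  unfold W
  rw [← Finset.sum_add_distrib]
  exact Finset.sum_le_sum fun i _ => w_add _ _

theorem W_single {F : Type*} [Field F] [DecidableEq F] {L : ℕ} (i : Fin L) (p : F × F) :
    W (Pi.single i p : Fin L → F × F) = w p := by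
  unfold W
  rw [Finset.sum_eq_single i]
  · simp
  · intro b _ hb; simp [Pi.single_eq_of_ne hb, w_zero]
  · simp

theorem psi_single {F : Type*} [Field F] {L : ℕ} (u₁ u₂ : Fin L → (Fin 4 → F))
    (i : Fin L) (p : F × F) :
    psi u₁ u₂ (Pi.single i p) = p.1 • u₁ i + p.2 • u₂ i := by
  change ∑ j : Fin L, _ = _
  rw [Finset.sum_eq_single i]
  · simp
  · intro b _ hb; simp [Pi.single_eq_of_ne hb]
  · simp

theorem li3 {F : Type*} [Field F] (v₁ v₂ v₃ : Fin 4 → F) :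
    Module.finrank F (Submodule.span F ({v₁, v₂, v₃} : Set (Fin 4 → F))) = 3 ↔
    ∀ x y z : F, x • v₁ + y • v₂ + z • v₃ = 0 → x = 0 ∧ y = 0 ∧ z = 0 := by
  have h := linearIndependent_iff_card_eq_finrank_span (R := F) (b := ![v₁, v₂, v₃])
  have hr : Set.range ![v₁, v₂, v₃] = {v₁, v₂, v₃} := by
    simp only [Matrix.range_cons, Matrix.range_empty, Set.union_empty, Set.singleton_union]
  rw [Set.finrank, hr, Fintype.card_fin, eq_comm] at h
  rw [← h, Fintype.linearIndependent_iff]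
  constructor
  · intro H x y z hxyz
    have := H ![x, y, z] (by simpa [Fin.sum_univ_three] using hxyz)
    exact ⟨by simpa using this 0, by simpa using this 1, by simpa using this 2⟩
  · intro H g hg i
    have := H (g 0) (g 1) (g 2) (by simpa [Fin.sum_univ_three] using hg)
    fin_cases i
    exacts [this.1, this.2.1, this.2.2]

theorem li2 {F : Type*} [Field F] (v₁ v₂ : Fin 4 → F) :
    Module.finrank F (Submodule.span F ({v₁, v₂} : Set (Fin 4 → F))) = 2 ↔
    ∀ x y : F, x • v₁ + y • v₂ = 0 → x = 0 ∧ y = 0 := by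
  have h := linearIndependent_iff_card_eq_finrank_span (R := F) (b := ![v₁, v₂])
  have hr : Set.range ![v₁, v₂] = {v₁, v₂} := by
    simp only [Matrix.range_cons, Matrix.range_empty, Set.union_empty, Set.singleton_union]
  rw [Set.finrank, hr, Fintype.card_fin, eq_comm] at h
  rw [← h, LinearIndependent.pair_iff]

/-- weight two patterns -/
def pat (F : Type*) [Field F] : Fin 3 → F × F := ![(1, -1), (1, 0), (0, 1)]

theorem pat_eval {F : Type*} [Field F] (u v : Fin 4 → F) (a : Fin 3) (x : F) :
    (x • pat F a).1 • u + (x • pat F a).2 • v = x • ![u - v, u, v] a := by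
  fin_cases a <;> simp [pat]
  module

theorem w_pat {F : Type*} [Field F] [DecidableEq F] (a : Fin 3) (x : F) :
    w (x • pat F a) ≤ 2 := by
  fin_cases a <;> simp [pat, w] <;> split_ifs <;> simp

theorem pat_ne {F : Type*} [Field F] (a : Fin 3) (x : F) (h : x • pat F a = 0) : x = 0 := by
  fin_cases a <;> simpa [pat] using h

theorem exists_pat {F : Type*} [Field F] [DecidableEq F] (p : F × F) (h : w p ≤ 2) :
    ∃ (a : Fin 3) (x : F), p = x • pat F a := by
  obtain ⟨a, b⟩ := p
  by_cases ha : a = 0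
  · exact ⟨2, b, by simp [pat, ha]⟩
  by_cases hb : b = 0
  · exact ⟨1, a, by simp [pat, hb]⟩
  by_cases hab : a + b = 0
  · refine ⟨0, a, ?_⟩
    simp [pat]; linear_combination hab
  · simp [w, ha, hb, hab] at h

theorem sum_three {L : ℕ} {M : Type*} [AddCommMonoid M] (T : Finset (Fin L)) (hT : T.card = 3)
    (f : Fin L → M) (hf : ∀ i, i ∉ T → f i = 0) :
    ∑ i, f i = f (T.orderEmbOfFin hT 0) + f (T.orderEmbOfFin hT 1)
      + f (T.orderEmbOfFin hT 2) := by
  rw [← Finset.sum_subset (Finset.subset_univ T) (fun i _ hi => hf i hi)]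
  conv_lhs => rw [← Finset.map_orderEmbOfFin_univ T hT]
  rw [Finset.sum_map, Fin.sum_univ_three]; rfl

theorem good_iff {F : Type*} [Field F] [DecidableEq F] {L : ℕ} (hL : 3 ≤ L)
    (u₁ u₂ : Fin L → (Fin 4 → F)) :
    GoodSeq L u₁ u₂ ↔ ∀ y, psi u₁ u₂ y = 0 → y ≠ 0 → 7 ≤ W y := by
  constructor
  · rintro ⟨h1, h2, h3⟩ y hy hy0
    by_contra hW
    have G2 : ∀ i j : Fin L, i < j → ∀ p q : F × F,
        (p.1 • u₁ i + p.2 • u₂ i) + (q.1 • u₁ j + q.2 • u₂ j) = 0 → p = 0 ∧ q = 0 := by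
      intro i j hij p q hpq
      have hm : p.1 • u₁ i + p.2 • u₂ i ∈
          Submodule.span F {u₁ i, u₂ i} ⊓ Submodule.span F {u₁ j, u₂ j} := by
        refine ⟨Submodule.mem_span_pair.2 ⟨_, _, rfl⟩, ?_⟩
        refine Submodule.mem_span_pair.2 ⟨-q.1, -q.2, ?_⟩
        rw [eq_neg_of_add_eq_zero_left hpq]; module
      rw [h2 i j hij, Submodule.mem_bot] at hm
      rw [hm, zero_add] at hpq
      exact ⟨Prod.ext_iff.2 ((li2 _ _).1 (h1 i) _ _ hm),
        Prod.ext_iff.2 ((li2 _ _).1 (h1 j) _ _ hpq)⟩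
    have hS : (Finset.univ.filter fun i => y i ≠ 0).card ≤ 3 := by
      have : (Finset.univ.filter fun i => y i ≠ 0).card * 2 ≤ W y := by
        calc _ ≤ ∑ i ∈ Finset.univ.filter (fun i => y i ≠ 0), w (y i) := by
              rw [← smul_eq_mul]
              exact Finset.card_nsmul_le_sum _ _ _ fun i hi => w_ge _ (by simpa using hi)
          _ ≤ W y := Finset.sum_le_sum_of_subset (Finset.filter_subset _ _)
      omega
    obtain ⟨T, hST, hT⟩ := Finset.exists_superset_card_eq hS (by simpa using hL)
    have key : ∀ i, i ∉ T → y i = 0 := fun i hi => by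
      by_contra h
      exact hi (hST (by simpa using h))
    have hWs := sum_three T hT (fun i => w (y i)) (fun i hi => by simp [key i hi, w_zero])
    have hps := sum_three T hT (fun i => (y i).1 • u₁ i + (y i).2 • u₂ i)
      (fun i hi => by simp [key i hi])
    have h01 : T.orderEmbOfFin hT 0 < T.orderEmbOfFin hT 1 := by simp
    have h12 : T.orderEmbOfFin hT 1 < T.orderEmbOfFin hT 2 := by simp
    have hall : ∀ i, y i ≠ 0 → i = T.orderEmbOfFin hT 0 ∨ i = T.orderEmbOfFin hT 1 ∨
        i = T.orderEmbOfFin hT 2 := by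
      intro i hi
      have hiT : i ∈ T := by by_contra h; exact hi (key i h)
      rw [← Finset.map_orderEmbOfFin_univ T hT] at hiT
      obtain ⟨k, -, hk⟩ := Finset.mem_map.1 hiT
      fin_cases k
      · exact Or.inl hk.symm
      · exact Or.inr (Or.inl hk.symm)
      · exact Or.inr (Or.inr hk.symm)
    generalize T.orderEmbOfFin hT 0 = i at *
    generalize T.orderEmbOfFin hT 1 = j at *
    generalize T.orderEmbOfFin hT 2 = t at *
    change W y = _ at hWs
    change psi u₁ u₂ y = _ at hps
    rw [hy] at hps
    have hfin : y i = 0 → y j = 0 → y t = 0 → False := by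
      intro a b c
      apply hy0
      funext m
      by_contra hm
      rcases hall m hm with rfl | rfl | rfl <;> contradiction
    by_cases hi : y i = 0
    · rw [hi] at hps
      have := G2 j t h12 (y j) (y t) (by rw [hps]; simp)
      exact hfin hi this.1 this.2
    by_cases hj : y j = 0
    · rw [hj] at hps
      have := G2 i t (h01.trans h12) (y i) (y t) (by rw [hps]; simp)
      exact hfin this.1 hj this.2
    by_cases ht : y t = 0
    · rw [ht] at hps
      have := G2 i j h01 (y i) (y j) (by rw [hps]; simp)
      exact hfin this.1 this.2 ht
    have hwi := w_ge _ hi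
    have hwj := w_ge _ hj
    have hwt := w_ge _ ht
    obtain ⟨a, x, hx⟩ := exists_pat (y i) (by omega)
    obtain ⟨b, x', hx'⟩ := exists_pat (y j) (by omega)
    obtain ⟨c, x'', hx''⟩ := exists_pat (y t) (by omega)
    rw [hx, hx', hx'', pat_eval, pat_eval, pat_eval] at hps
    have := (li3 _ _ _).1 (h3 i j t h01 h12 a b c) x x' x'' hps.symm
    apply hi
    rw [hx, this.1, zero_smul]
  · intro H
    have hz : ∀ y, psi u₁ u₂ y = 0 → W y ≤ 6 → y = 0 := by
      intro y hy hw
      by_contra h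
      have := H y hy h
      omega
    have G2 : ∀ i j : Fin L, i ≠ j → ∀ p q : F × F,
        (p.1 • u₁ i + p.2 • u₂ i) + (q.1 • u₁ j + q.2 • u₂ j) = 0 → p = 0 ∧ q = 0 := by
      intro i j hij p q hpq
      have := hz (Pi.single i p + Pi.single j q) (by
        rw [map_add, psi_single, psi_single, hpq]) (by
        refine (W_add _ _).trans ?_
        rw [W_single, W_single]
        have := w_le p
        have := w_le q
        omega)
      have h1 := congrFun this i
      have h2 := congrFun this j
      simp [hij, hij.symm] at h1 h2
      exact ⟨h1, h2⟩
    refine ⟨?_, ?_, ?_⟩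
    · intro i
      rw [li2]
      intro x y hxy
      obtain ⟨j, hj⟩ : ∃ j : Fin L, i ≠ j := by
        have : Nontrivial (Fin L) := Fin.nontrivial_iff_two_le.2 (by omega)
        exact (exists_ne i).imp fun _ h => h.symm
      have := (G2 i j hj (x, y) 0 (by simpa using hxy)).1
      exact Prod.ext_iff.1 this
    · intro i j hij
      rw [Submodule.eq_bot_iff]
      rintro v ⟨hv1, hv2⟩
      obtain ⟨a, b, rfl⟩ := Submodule.mem_span_pair.1 hv1
      obtain ⟨c, d, hcd⟩ := Submodule.mem_span_pair.1 hv2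
      have := (G2 i j hij.ne (a, b) (-c, -d) (by
        simp only [← hcd]; module)).1
      have := Prod.ext_iff.1 this
      simp at this
      simp [this]
    · intro i j t hij hjt a b c
      rw [li3]
      intro x y z hxyz
      have hit := hij.trans hjt
      have := hz (Pi.single i (x • pat F a) + Pi.single j (y • pat F b)
          + Pi.single t (z • pat F c)) (by
        rw [map_add, map_add, psi_single, psi_single, psi_single, pat_eval, pat_eval, pat_eval,
          hxyz]) (by
        refine (W_add _ _).trans ?_
        refine (Nat.add_le_add_right (W_add _ _) _).trans ?_
        rw [W_single, W_single, W_single]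
        have := w_pat a x
        have := w_pat b y
        have := w_pat c z
        omega)
      have h1 := congrFun this i
      have h2 := congrFun this j
      have h3 := congrFun this t
      simp only [Pi.add_apply, Pi.single_eq_same, Pi.single_eq_of_ne hij.ne,
        Pi.single_eq_of_ne hij.ne', Pi.single_eq_of_ne hjt.ne, Pi.single_eq_of_ne hjt.ne',
        Pi.single_eq_of_ne hit.ne, Pi.single_eq_of_ne hit.ne', add_zero, zero_add,
        Pi.zero_apply] at h1 h2 h3
      exact ⟨pat_ne _ _ h1, pat_ne _ _ h2, pat_ne _ _ h3⟩

/-- local coordinates -/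
def tc {F : Type*} [Field F] (k : Fin 3) (p : F × F) : F := ![p.1, p.2, -(p.1 + p.2)] k

theorem tc_add {F : Type*} [Field F] (k : Fin 3) (p q : F × F) :
    tc k (p + q) = tc k p + tc k q := by
  fin_cases k <;> simp [tc]
  ring

theorem tc_smul {F : Type*} [Field F] (k : Fin 3) (a : F) (p : F × F) :
    tc k (a • p) = a * tc k p := by
  fin_cases k <;> simp [tc]
  ring

/-- encoder -/
def phi {F : Type*} [Field F] {L : ℕ} (e : Fin 3 × Fin L ≃ Fin (3 * L)) (h : Fin (3 * L) → F) :
    (Fin L → F × F) →ₗ[F] (Fin (3 * L) → F) where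
  toFun y := fun m => (h m)⁻¹ * tc (e.symm m).1 (y (e.symm m).2)
  map_add' x y := by
    funext m
    simp only [Pi.add_apply, tc_add, mul_add]
  map_smul' a y := by
    funext m
    simp only [Pi.smul_apply, tc_smul, RingHom.id_apply, smul_eq_mul]
    ring

theorem phi_apply {F : Type*} [Field F] {L : ℕ} (e : Fin 3 × Fin L ≃ Fin (3 * L))
    (h : Fin (3 * L) → F) (y : Fin L → F × F) (k : Fin 3) (i : Fin L) :
    phi e h y (e (k, i)) = (h (e (k, i)))⁻¹ * tc k (y i) := by
  simp [phi]

theorem wt_phi {F : Type*} [Field F] [DecidableEq F] {L : ℕ} (e : Fin 3 × Fin L ≃ Fin (3 * L))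
    (h : Fin (3 * L) → F) (hh : ∀ m, h m ≠ 0) (y : Fin L → F × F) :
    wt (phi e h y) = W y := by
  unfold wt W
  rw [Finset.card_filter, ← Equiv.sum_comp e, Fintype.sum_prod_type, Fin.sum_univ_three,
    ← Finset.sum_add_distrib, ← Finset.sum_add_distrib]
  refine Finset.sum_congr rfl fun i _ => ?_
  have key : ∀ (k : Fin 3) (b : F), (tc k (y i) = 0 ↔ b = 0) →
      (if phi e h y (e (k, i)) ≠ 0 then 1 else 0) = if b ≠ 0 then 1 else 0 := by
    intro k b hb
    rw [phi_apply]
    by_cases h0 : b = 0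
    · simp [hb.2 h0, h0]
    · have := mt hb.1 h0
      simp [this, h0, hh]
  rw [key 0 (y i).1 (by simp [tc]), key 1 (y i).2 (by simp [tc]),
    key 2 ((y i).1 + (y i).2) (by simp only [tc]; simp [-neg_add_rev])]
  rfl

theorem phi_inj {F : Type*} [Field F] {L : ℕ} (e : Fin 3 × Fin L ≃ Fin (3 * L))
    (h : Fin (3 * L) → F) (hh : ∀ m, h m ≠ 0) : Function.Injective (phi e h) := by
  rw [← LinearMap.ker_eq_bot, LinearMap.ker_eq_bot']
  intro y hy
  funext i
  have h0 := congrFun hy (e (0, i))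
  have h1 := congrFun hy (e (1, i))
  rw [phi_apply] at h0 h1
  simp [hh, tc] at h0 h1
  exact Prod.ext h0 h1

theorem lrg_data {F : Type*} [Field F] {L : ℕ} (C : Submodule F (Fin (3 * L) → F))
    (H : HasDisjointLRG C 2) :
    ∃ (e : Fin 3 × Fin L ≃ Fin (3 * L)) (c : Fin L → Fin (3 * L) → F),
      (∀ i, c i ∈ dualCode C) ∧ ∀ i k j, c i (e (k, j)) ≠ 0 ↔ j = i := by
  classical
  obtain ⟨P, hP3, hPu, hPc⟩ := H
  let f : (Σ G : P, G.1) → Fin (3 * L) := fun z => z.2.1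
  have hf : Function.Bijective f := by
    constructor
    · rintro ⟨⟨G, hG⟩, ⟨x, hx⟩⟩ ⟨⟨G', hG'⟩, ⟨x', hx'⟩⟩ hxx
      change x = x' at hxx
      subst hxx
      obtain rfl := (hPu x).unique ⟨hG, hx⟩ ⟨hG', hx'⟩
      rfl
    · intro x
      obtain ⟨G, ⟨hG, hx⟩, -⟩ := hPu x
      exact ⟨⟨⟨G, hG⟩, ⟨x, hx⟩⟩, rfl⟩
  have hcard : Fintype.card P = L := by
    have := Fintype.card_of_bijective hf
    rw [Fintype.card_sigma, Fintype.card_fin] at this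
    have h2 : ∑ G : P, Fintype.card G.1 = ∑ G : P, 3 :=
      Finset.sum_congr rfl fun G _ => by rw [Fintype.card_coe]; exact hP3 G.1 G.2
    rw [h2, Finset.sum_const, Finset.card_univ, smul_eq_mul] at this
    omega
  let eP : Fin L ≃ P := (Fintype.equivFinOfCardEq hcard).symm
  let eG : ∀ G : P, Fin 3 ≃ G.1 := fun G =>
    (Fintype.equivFinOfCardEq (by rw [Fintype.card_coe]; exact hP3 G.1 G.2)).symm
  let e : Fin 3 × Fin L ≃ Fin (3 * L) :=
    (Equiv.prodComm _ _).trans ((Equiv.sigmaEquivProd (Fin L) (Fin 3)).symm.trans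
      ((Equiv.sigmaCongr eP (fun i => eG (eP i))).trans (Equiv.ofBijective f hf)))
  have he : ∀ k j, e (k, j) = (eG (eP j) k).1 := fun k j => rfl
  choose c hc hcs using hPc
  refine ⟨e, fun i => c (eP i).1 (eP i).2, fun i => hc _ _, ?_⟩
  intro i k j
  rw [hcs, he]
  constructor
  · intro hm
    have := (hPu _).unique ⟨(eP i).2, hm⟩ ⟨(eP j).2, (eG (eP j) k).2⟩
    exact (eP.injective (Subtype.ext this)).symm
  · rintro rfl
    exact (eG (eP j) k).2

theorem psi_eq {F : Type*} [Field F] {L : ℕ} (f : (Fin L → F × F) →ₗ[F] (Fin 4 → F)) :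
    psi (fun i => f (Pi.single i (1, 0))) (fun i => f (Pi.single i (0, 1))) = f := by
  refine LinearMap.pi_ext fun i p => ?_
  rw [psi_single, ← map_smul, ← map_smul, ← map_add, ← Pi.single_smul, ← Pi.single_smul,
    ← Pi.single_add]
  simp

theorem finrank_V {F : Type*} [Field F] {L : ℕ} : Module.finrank F (Fin L → F × F) = 2 * L := by
  rw [Module.finrank_pi_fintype]
  simp [mul_comm]

theorem forward {F : Type*} [Field F] [DecidableEq F] {L : ℕ} (hL : 3 ≤ L)
    (C : Submodule F (Fin (3 * L) → F)) (d : ℕ) (hC : Module.finrank F C = 2 * L - 4)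
    (hd : IsMinDist C d) (h7 : 7 ≤ d) (H : HasDisjointLRG C 2) :
    ∃ u₁ u₂ : Fin L → (Fin 4 → F), GoodSeq L u₁ u₂ := by
  obtain ⟨e, c, hc, hcs⟩ := lrg_data C H
  let h : Fin (3 * L) → F := fun m => c (e.symm m).2 m
  have hh : ∀ m, h m ≠ 0 := by
    intro m
    obtain ⟨⟨k, i⟩, rfl⟩ := e.surjective m
    simp only [h, Equiv.symm_apply_apply]
    exact (hcs i k i).2 rfl
  have hle : C ≤ LinearMap.range (phi e h) := by
    intro x hx
    refine ⟨fun i => (h (e (0, i)) * x (e (0, i)), h (e (1, i)) * x (e (1, i))), ?_⟩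
    funext m
    obtain ⟨⟨k, i⟩, rfl⟩ := e.surjective m
    rw [phi_apply, inv_mul_eq_iff_eq_mul₀ (hh _)]
    have hs := hc i x hx
    rw [← Equiv.sum_comp e, Fintype.sum_prod_type] at hs
    have h2 : ∀ k, ∑ j, x (e (k, j)) * c i (e (k, j)) = x (e (k, i)) * h (e (k, i)) := by
      intro k
      rw [Finset.sum_eq_single i]
      · simp [h]
      · intro j _ hj
        have : c i (e (k, j)) = 0 := by
          by_contra h0
          exact hj ((hcs _ _ _).1 h0)
        rw [this, mul_zero]
      · simp
    simp only [h2, Fin.sum_univ_three] at hs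
    fin_cases k
    · simp [tc]
    · simp [tc]
    · simp only [tc]
      simp
      linear_combination -hs
  let K := C.comap (phi e h)
  have hmap : K.map (phi e h) = C := Submodule.map_comap_eq_self hle
  have hK : Module.finrank F K = 2 * L - 4 := by
    rw [← hC, ← hmap]
    exact (LinearEquiv.finrank_eq (Submodule.equivMapOfInjective _ (phi_inj e h hh) K))
  have hQ : Module.finrank F ((Fin L → F × F) ⧸ K) = Module.finrank F (Fin 4 → F) := by
    have := Submodule.finrank_quotient_add_finrank K
    rw [hK, finrank_V] at this
    rw [Module.finrank_fin_fun]
    omega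
  let f : (Fin L → F × F) →ₗ[F] (Fin 4 → F) :=
    (LinearEquiv.ofFinrankEq _ _ hQ).toLinearMap ∘ₗ K.mkQ
  refine ⟨fun i => f (Pi.single i (1, 0)), fun i => f (Pi.single i (0, 1)),
    (good_iff hL _ _).2 ?_⟩
  rw [psi_eq]
  intro y hy hy0
  have hyK : y ∈ K := by
    simpa [f] using hy
  have := hd.2 (phi e h y) hyK (fun h0 => hy0 (phi_inj e h hh (by rw [h0, map_zero])))
  rw [wt_phi e h hh] at this
  omega

theorem backward {F : Type*} [Field F] [DecidableEq F] {L : ℕ} (hL : 3 ≤ L)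
    (u₁ u₂ : Fin L → (Fin 4 → F)) (hg : GoodSeq L u₁ u₂) :
    ∃ (C : Submodule F (Fin (3 * L) → F)) (d : ℕ),
        Module.finrank F C = 2 * L - 4 ∧ IsMinDist C d ∧ 7 ≤ d ∧ d ≤ 8 ∧
        HasLocality C 2 ∧ HasDisjointLRG C 2 := by
  classical
  rw [good_iff hL] at hg
  let e : Fin 3 × Fin L ≃ Fin (3 * L) := finProdFinEquiv
  let φ := phi e (fun _ => (1 : F))
  have hφ : Function.Injective φ := phi_inj e _ (fun _ => one_ne_zero)
  have hwt : ∀ y, wt (φ y) = W y := wt_phi e _ (fun _ => one_ne_zero)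
  let ψ := psi u₁ u₂
  let i0 : Fin L := ⟨0, by omega⟩
  let i1 : Fin L := ⟨1, by omega⟩
  let i2 : Fin L := ⟨2, by omega⟩
  have h01 : i0 ≠ i1 := by simp [i0, i1]
  have h02 : i0 ≠ i2 := by simp [i0, i2]
  have h12 : i1 ≠ i2 := by simp [i1, i2]
  let s2 : (F × F) × (F × F) →ₗ[F] (Fin L → F × F) :=
    (LinearMap.single F (fun _ => F × F) i0).coprod (LinearMap.single F (fun _ => F × F) i1)
  have hs2 : ∀ p, s2 p = Pi.single i0 p.1 + Pi.single i1 p.2 := fun p => rfl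
  have hsurj : LinearMap.range ψ = ⊤ := by
    have hinj : Function.Injective (ψ ∘ₗ s2) := by
      rw [← LinearMap.ker_eq_bot, LinearMap.ker_eq_bot']
      intro p hp
      have hz : s2 p = 0 := by
        by_contra h0
        have h7 := hg (s2 p) hp h0
        have := W_add (Pi.single i0 p.1) (Pi.single i1 p.2)
        rw [← hs2, W_single, W_single] at this
        have := w_le p.1
        have := w_le p.2
        omega
      rw [hs2] at hz
      have a := congrFun hz i0
      have b := congrFun hz i1
      simp [h01, h01.symm] at a b
      exact Prod.ext a b
    have h1 : Function.Surjective (ψ ∘ₗ s2) :=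
      (LinearMap.injective_iff_surjective_of_finrank_eq_finrank (by simp)).1 hinj
    rw [LinearMap.range_eq_top]
    exact Function.Surjective.of_comp (g := s2) h1
  have hker : Module.finrank F (LinearMap.ker ψ) = 2 * L - 4 := by
    have := LinearMap.finrank_range_add_finrank_ker ψ
    rw [hsurj, finrank_top, finrank_V, Module.finrank_fin_fun] at this
    omega
  let C := (LinearMap.ker ψ).map φ
  have hC : Module.finrank F C = 2 * L - 4 := by
    rw [← hker]
    exact (LinearEquiv.finrank_eq (Submodule.equivMapOfInjective _ hφ _)).symm
  have hC7 : ∀ c ∈ C, c ≠ 0 → 7 ≤ wt c := by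
    rintro _ ⟨y, hy, rfl⟩ h0
    rw [hwt]
    exact hg y hy (by rintro rfl; exact h0 (map_zero _))
  have hC8 : ∃ c ∈ C, c ≠ 0 ∧ wt c ≤ 8 := by
    let s3 : (F × F) × (F × F) × F →ₗ[F] (Fin L → F × F) :=
      (LinearMap.single F (fun _ => F × F) i0).coprod
        ((LinearMap.single F (fun _ => F × F) i1).coprod
          ((LinearMap.single F (fun _ => F × F) i2) ∘ₗ (LinearMap.inl F F F)))
    have hs3 : ∀ p, s3 p = Pi.single i0 p.1 + (Pi.single i1 p.2.1 + Pi.single i2 (p.2.2, 0)) :=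
      fun p => rfl
    have hk : LinearMap.ker (ψ ∘ₗ s3) ≠ ⊥ :=
      LinearMap.ker_ne_bot_of_finrank_lt (by simp)
    obtain ⟨p, hp, hp0⟩ := Submodule.exists_mem_ne_zero_of_ne_bot hk
    have hs0 : s3 p ≠ 0 := by
      intro hz
      apply hp0
      rw [hs3] at hz
      have a := congrFun hz i0
      have b := congrFun hz i1
      have c := congrFun hz i2
      simp [h01, h01.symm, h02, h02.symm, h12, h12.symm] at a b c
      exact Prod.ext a (Prod.ext b c)
    refine ⟨φ (s3 p), ⟨s3 p, hp, rfl⟩, fun h0 => hs0 (hφ (by rw [h0, map_zero])), ?_⟩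
    rw [hwt]
    have t1 := W_add (Pi.single i0 p.1) (Pi.single i1 p.2.1 + Pi.single i2 (p.2.2, 0))
    have t2 := W_add (Pi.single i1 p.2.1) (Pi.single i2 (p.2.2, 0))
    rw [← hs3] at t1
    rw [W_single] at t1
    rw [W_single, W_single] at t2
    have := w_le p.1
    have := w_le p.2.1
    have : w (p.2.2, (0 : F)) ≤ 2 := by
      simp only [w]; simp; split_ifs <;> simp
    omega
  have hex : ∃ d, ∃ c ∈ C, c ≠ 0 ∧ wt c = d := by
    obtain ⟨c, h1, h2, -⟩ := hC8
    exact ⟨_, c, h1, h2, rfl⟩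
  have hmin : ∀ c ∈ C, c ≠ 0 → Nat.find hex ≤ wt c := fun c h1 h2 =>
    Nat.find_min' hex ⟨c, h1, h2, rfl⟩
  let cw : Fin L → Fin (3 * L) → F := fun i m => if (e.symm m).2 = i then 1 else 0
  have hcw : ∀ i, cw i ∈ dualCode C := by
    rintro i _ ⟨y, hy, rfl⟩
    rw [← Equiv.sum_comp e, Fintype.sum_prod_type]
    simp [cw, Fin.sum_univ_three, φ, phi_apply, tc]
  let G : Fin L → Finset (Fin (3 * L)) := fun i => Finset.univ.filter fun m => (e.symm m).2 = i
  have hGc : ∀ i, (G i).card = 3 := by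
    intro i
    simp only [G]
    rw [Finset.card_filter, ← Equiv.sum_comp e, Fintype.sum_prod_type]
    simp
  refine ⟨C, Nat.find hex, hC, ⟨Nat.find_spec hex, hmin⟩, ?_, ?_, ?_, ?_⟩
  · obtain ⟨c, h1, h2, h3⟩ := Nat.find_spec hex
    rw [← h3]
    exact hC7 c h1 h2
  · obtain ⟨c, h1, h2, h3⟩ := hC8
    exact (hmin c h1 h2).trans h3
  · intro m
    refine ⟨cw (e.symm m).2, hcw _, ?_, by simp [cw]⟩
    have := hGc (e.symm m).2
    simp only [wt, cw, ne_eq, ite_eq_right_iff, one_ne_zero, imp_false, not_not]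
    exact this.le
  · refine ⟨Finset.univ.image G, ?_, ?_, ?_⟩
    · intro g hgm
      obtain ⟨i, -, rfl⟩ := Finset.mem_image.1 hgm
      exact hGc i
    · intro m
      refine ⟨G (e.symm m).2, ⟨Finset.mem_image_of_mem _ (Finset.mem_univ _), by simp [G]⟩, ?_⟩
      rintro g ⟨hgm, hm⟩
      obtain ⟨i, -, rfl⟩ := Finset.mem_image.1 hgm
      simp only [G, Finset.mem_filter, Finset.mem_univ, true_and] at hm
      rw [hm]
    · intro g hgm
      obtain ⟨i, -, rfl⟩ := Finset.mem_image.1 hgm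
      exact ⟨cw i, hcw i, fun m => by simp [cw, G]⟩

end L5

/-- **Lemma 5.** Let `q` be a prime power (the cardinality of a finite field `F`) and
`L ≥ 3`. There exists a linear code over `F` with disjoint local repair groups, length
`n = 3L`, dimension `k = 2L − 4`, minimum distance `d` with `7 ≤ d ≤ 8`, and locality
`r = 2`, if and only if there exists a sequence of vectors `u_1^(i), u_2^(i) ∈ F_q^4`
satisfying conditions C.1, C.2 and C.3. -/
theorem lemma5_iff
    (F : Type*) [Field F] [Fintype F] [DecidableEq F]
    (L : ℕ) (hL : 3 ≤ L) :
    (∃ (C : Submodule F (Fin (3 * L) → F)) (d : ℕ),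
        Module.finrank F C = 2 * L - 4 ∧ IsMinDist C d ∧ 7 ≤ d ∧ d ≤ 8 ∧
        HasLocality C 2 ∧ HasDisjointLRG C 2) ↔
    (∃ u₁ u₂ : Fin L → (Fin 4 → F), GoodSeq L u₁ u₂) := by
  constructor
  · rintro ⟨C, d, hC, hd, h7, -, -, H⟩
    exact L5.forward hL C d hC hd h7 H
  · rintro ⟨u₁, u₂, h⟩
    exact L5.backward hL u₁ u₂ h
end

section
/- (Theorem 2, existence of vector sequences) Let q ≥ 4 be a prime power. Then there exist an integer L ≥ max{⌈(√2/3)·q⌉, 3} and vectors u_1^(i), u_2^(i) ∈ F_q^4 (i = 1,…,L) satisfying conditions C.1, C.2 and C.3. -/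
open Finset in
theorem step_lemma {F K : Type*} [Field F] [Fintype F] [Field K] [Fintype K] [Algebra F K]
    (ω : K) (hω : ∀ t : F, algebraMap F K t + ω ≠ 0)
    (s : ℕ → K) (t : ℕ → Fin 3 → F) (m : ℕ) (h4 : 4 ≤ Fintype.card F)
    (hm : 9 * (m * (m - 1)) < 2 * (Fintype.card K - m)) :
    ∃ s' : K, ∃ t' : Fin 3 → F, (∀ i < m, s i ≠ s') ∧ Function.Injective t' ∧
      ∀ i j, i < j → j < m → ∀ a b c (l : F),
        t' c = l * t i a + (1 - l) * t j b →
        s' * (algebraMap F K (t' c) + ω) ≠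
          algebraMap F K l * (s i * (algebraMap F K (t i a) + ω)) +
          algebraMap F K (1 - l) * (s j * (algebraMap F K (t j b) + ω)) := by
  classical
  set q := Fintype.card F with hq
  let dom : Finset ((Σ _ : ℕ, ℕ) × (Fin 3 × Fin 3 × F)) :=
    ((range m).sigma range) ×ˢ (univ ×ˢ (univ ×ˢ ({0, 1} : Finset F)ᶜ))
  let T : ((Σ _ : ℕ, ℕ) × (Fin 3 × Fin 3 × F)) → F := fun p =>
    p.2.2.2 * t p.1.2 p.2.1 + (1 - p.2.2.2) * t p.1.1 p.2.2.1
  let S : ((Σ _ : ℕ, ℕ) × (Fin 3 × Fin 3 × F)) → K := fun p =>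
    (algebraMap F K p.2.2.2 * (s p.1.2 * (algebraMap F K (t p.1.2 p.2.1) + ω)) +
      algebraMap F K (1 - p.2.2.2) * (s p.1.1 * (algebraMap F K (t p.1.1 p.2.2.1) + ω))) /
      (algebraMap F K (T p) + ω)
  let Bad : Finset (K × F) := dom.image fun p => (S p, T p)
  let U : Finset K := ((range m).image s)ᶜ
  have h01 : #(({0, 1} : Finset F)ᶜ) = q - 2 := by
    rw [card_compl, card_pair zero_ne_one]
  have hdom : 2 * #dom = (9 * (m * (m - 1))) * (q - 2) := by
    have := Finset.sum_range_id_mul_two m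
    simp only [dom, card_product, card_sigma, card_range, h01, card_univ, Fintype.card_fin]
    rw [← this]; ring
  have hU : Fintype.card K - m ≤ #U := by
    rw [card_compl]
    have := card_image_le (s := range m) (f := s)
    rw [card_range] at this
    omega
  have hBad : #Bad < #U * (q - 2) := by
    have h1 : #Bad ≤ #dom := card_image_le
    have h2 : (9 * (m * (m - 1))) * (q - 2) < (2 * #U) * (q - 2) :=
      Nat.mul_lt_mul_of_pos_right (by omega) (by omega)
    have : 2 * #U * (q - 2) = 2 * (#U * (q - 2)) := by ring
    omega
  obtain ⟨s', hs', hlt⟩ := exists_card_fiber_lt_of_card_lt_mul (f := Prod.fst) hBad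
  let G : Finset F := (univ.filter fun t' => (s', t') ∈ Bad)ᶜ
  have hG : 3 ≤ #G := by
    have : #(univ.filter fun t' => (s', t') ∈ Bad) ≤ #{x ∈ Bad | x.1 = s'} := by
      apply card_le_card_of_injOn (fun t' => (s', t'))
      · intro x hx; simpa using hx
      · intro x _ y _ h; simpa using h
    rw [card_compl]
    omega
  obtain ⟨G', hG', hc⟩ := exists_subset_card_eq hG
  let e := G'.equivFinOfCardEq hc
  have hs'' : ∀ i < m, s i ≠ s' := by
    intro i hi h
    simp only [U, mem_compl, mem_image, mem_range, not_exists] at hs'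
    exact hs' i ⟨hi, h⟩
  refine ⟨s', fun c => (e.symm c : F), hs'', ?_, ?_⟩
  · exact Subtype.val_injective.comp e.symm.injective
  · intro i j hij hj a b c l ht h
    beta_reduce at ht h
    have hmem := hG' (e.symm c).2
    simp only [G, mem_compl, mem_filter, mem_univ, true_and] at hmem
    set x : F := (e.symm c : F)
    have hx := hω x
    by_cases h0 : l = 0
    · subst h0
      have : x = t j b := by simpa using ht
      rw [this] at h hx
      simp only [map_zero, zero_mul, zero_add, sub_zero, map_one, one_mul] at h
      exact hs'' j hj (mul_right_cancel₀ hx h).symm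
    by_cases h1 : l = 1
    · subst h1
      have : x = t i a := by simpa using ht
      rw [this] at h hx
      simp only [sub_self, map_zero, zero_mul, add_zero, map_one, one_mul] at h
      exact hs'' i (hij.trans hj) (mul_right_cancel₀ hx h).symm
    apply hmem
    refine mem_image.2 ⟨(⟨j, i⟩, (a, b, l)), ?_, ?_⟩
    · simp [dom, hj, hij, h0, h1]
    · have hT : T (⟨j, i⟩, (a, b, l)) = x := ht.symm
      refine Prod.ext ?_ hT
      simp only [S, hT]
      rw [div_eq_iff hx]
      exact h.symm

theorem seq_lemma {F K : Type*} [Field F] [Fintype F] [Field K] [Fintype K] [Algebra F K]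
    (ω : K) (hω : ∀ t : F, algebraMap F K t + ω ≠ 0) (h4 : 4 ≤ Fintype.card F) (m : ℕ)
    (hm : ∀ n < m, 9 * (n * (n - 1)) < 2 * (Fintype.card K - n)) :
    ∃ (s : ℕ → K) (t : ℕ → Fin 3 → F), (∀ i j, i < j → j < m → s i ≠ s j) ∧
      (∀ i < m, Function.Injective (t i)) ∧
      ∀ i j k, i < j → j < k → k < m → ∀ a b c (l : F),
        t k c = l * t i a + (1 - l) * t j b →
        s k * (algebraMap F K (t k c) + ω) ≠
          algebraMap F K l * (s i * (algebraMap F K (t i a) + ω)) +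
          algebraMap F K (1 - l) * (s j * (algebraMap F K (t j b) + ω)) := by
  induction m with
  | zero => exact ⟨fun _ => 0, fun _ _ => 0, by simp, by simp, by simp⟩
  | succ m ih =>
    obtain ⟨s, t, h1, h2, h3⟩ := ih fun n hn => hm n (by omega)
    obtain ⟨s', t', g1, g2, g3⟩ := step_lemma ω hω s t m h4 (hm m (by omega))
    refine ⟨fun i => if i < m then s i else s', fun i => if i < m then t i else t', ?_, ?_, ?_⟩
    · intro i j hij hj
      have hi : i < m := by omega
      by_cases hj' : j < m
      · simpa [hi, hj'] using h1 i j hij hj'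
      · simpa [hi, hj'] using g1 i hi
    · intro i _
      by_cases hi : i < m
      · simpa [hi] using h2 i hi
      · simpa [hi] using g2
    · intro i j k hij hjk hk a b c l
      have hj : j < m := by omega
      have hi : i < m := by omega
      by_cases hk' : k < m
      · simpa only [hi, hj, hk', if_true] using h3 i j k hij hjk hk' a b c l
      · simpa only [hi, hj, hk', if_true, if_false] using g3 i j hij hj a b c l

/-- The point with parameter `t` on the spread line with slope `s`. -/
def ptv {F K : Type*} [Field F] [Field K] [Algebra F K] (ω s : K) (t : F) : K × K :=
  (algebraMap F K t + ω, s * (algebraMap F K t + ω))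

theorem li3 {F K : Type*} [Field F] [Field K] [Algebra F K]
    (ω : K) (hω : ∀ a b : F, algebraMap F K a + algebraMap F K b * ω = 0 → a = 0 ∧ b = 0)
    (s₁ s₂ s₃ : K) (t₁ t₂ t₃ : F) (hs : s₁ ≠ s₂)
    (h : ∀ l : F, t₃ = l * t₁ + (1 - l) * t₂ →
      s₃ * (algebraMap F K t₃ + ω) ≠ algebraMap F K l * (s₁ * (algebraMap F K t₁ + ω)) +
        algebraMap F K (1 - l) * (s₂ * (algebraMap F K t₂ + ω)))
    (a b c : F) (h0 : a • ptv ω s₁ t₁ + b • ptv ω s₂ t₂ + c • ptv ω s₃ t₃ = 0) :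
    a = 0 ∧ b = 0 ∧ c = 0 := by
  have e1 := congrArg Prod.fst h0
  have e2 := congrArg Prod.snd h0
  simp only [ptv, Prod.fst_add, Prod.snd_add, Prod.smul_fst, Prod.smul_snd,
    Prod.fst_zero, Prod.snd_zero] at e1 e2
  simp only [Algebra.smul_def] at e1 e2
  obtain ⟨f1, f2⟩ := hω (a * t₁ + b * t₂ + c * t₃) (a + b + c) (by
    simp only [map_add, map_mul]; linear_combination e1)
  have hb : b = - a - c := by linear_combination f2
  subst hb
  by_cases hc : c = 0
  · subst hc
    by_cases ha : a = 0
    · simp [ha]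
    · exfalso
      have ht : t₁ = t₂ := by
        apply mul_left_cancel₀ ha; linear_combination f1
      subst ht
      have hx : algebraMap F K t₁ + ω ≠ 0 := fun hx => by
        have := (hω t₁ 1 (by simpa using hx)).2
        exact one_ne_zero this
      have ha' : algebraMap F K a ≠ 0 := by simpa using ha
      apply hs
      apply mul_right_cancel₀ hx
      apply mul_left_cancel₀ ha'
      simp only [map_sub, map_neg, map_zero] at e2
      linear_combination e2
  · exfalso
    have hc' : algebraMap F K c ≠ 0 := by simpa using hc
    have hl : c * (-a / c) = -a := by field_simp
    have hl' : algebraMap F K c * algebraMap F K (-a / c) = - algebraMap F K a := by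
      rw [← map_mul, hl, map_neg]
    refine h (-a / c) ?_ ?_
    · apply mul_left_cancel₀ hc
      linear_combination f1 - (t₁ - t₂) * hl
    · apply mul_left_cancel₀ hc'
      simp only [map_sub, map_neg, map_one] at e2 ⊢
      linear_combination e2 - (s₁ * (algebraMap F K t₁ + ω) - s₂ * (algebraMap F K t₂ + ω)) * hl'

theorem exists_ext (F : Type*) [Field F] [Fintype F] :
    ∃ (K : Type) (_ : Field K) (_ : Fintype K) (_ : Algebra F K), Module.finrank F K = 2 := by
  obtain ⟨p, hp⟩ := CharP.exists F
  have : Fact p.Prime := ⟨CharP.char_is_prime F p⟩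
  exact ⟨FiniteField.Extension F p 2, inferInstance, Fintype.ofFinite _, inferInstance,
    FiniteField.finrank_extension F p 2⟩

theorem exists_omega {F K : Type*} [Field F] [Field K] [Algebra F K]
    (h : Module.finrank F K = 2) :
    ∃ ω : K, ∀ a b : F, algebraMap F K a + algebraMap F K b * ω = 0 → a = 0 ∧ b = 0 := by
  have : ∃ ω : K, ω ∉ Set.range (algebraMap F K) := by
    by_contra! hc
    have hbt : (⊥ : Subalgebra F K) = ⊤ := by
      rw [eq_top_iff]; intro x _
      exact Algebra.mem_bot.2 (hc x)
    have := Subalgebra.bot_eq_top_iff_finrank_eq_one.1 hbt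
    omega
  obtain ⟨ω, hω⟩ := this
  refine ⟨ω, fun a b h => ?_⟩
  by_cases hb : b = 0
  · subst hb; simpa using h
  · exfalso; apply hω
    have hb' : algebraMap F K b ≠ 0 := by simpa using hb
    refine ⟨-a / b, ?_⟩
    rw [map_div₀, div_eq_iff hb', map_neg]
    linear_combination -h

theorem good_of_seq {F K : Type*} [Field F] [Fintype F] [Field K] [Fintype K] [Algebra F K]
    (hK : Module.finrank F K = 2) (ω : K)
    (hω : ∀ a b : F, algebraMap F K a + algebraMap F K b * ω = 0 → a = 0 ∧ b = 0)
    (m : ℕ) (s : ℕ → K) (t : ℕ → Fin 3 → F)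
    (h1 : ∀ i j, i < j → j < m → s i ≠ s j)
    (h2 : ∀ i < m, Function.Injective (t i))
    (h3 : ∀ i j k, i < j → j < k → k < m → ∀ a b c (l : F),
        t k c = l * t i a + (1 - l) * t j b →
        s k * (algebraMap F K (t k c) + ω) ≠
          algebraMap F K l * (s i * (algebraMap F K (t i a) + ω)) +
          algebraMap F K (1 - l) * (s j * (algebraMap F K (t j b) + ω))) :
    ∃ u₁ u₂ : Fin m → (Fin 4 → F), GoodSeq m u₁ u₂ := by
  have : Module.Finite F K := Module.Finite.of_finite
  have hfr : Module.finrank F (K × K) = Module.finrank F (Fin 4 → F) := by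
    rw [Module.finrank_prod, hK, Module.finrank_fin_fun]
  let e : (K × K) ≃ₗ[F] (Fin 4 → F) := LinearEquiv.ofFinrankEq _ _ hfr
  let l : ℕ → F := fun i => (t i 0 - t i 2) / (t i 1 - t i 2)
  have hne : ∀ i < m, t i 1 - t i 2 ≠ 0 := fun i hi h =>
    absurd (h2 i hi (sub_eq_zero.1 h)) (by decide)
  have hl : ∀ i < m, l i * (t i 1 - t i 2) = t i 0 - t i 2 := fun i hi =>
    div_mul_cancel₀ _ (hne i hi)
  have hl0 : ∀ i < m, l i ≠ 0 := fun i hi h => by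
    have := hl i hi
    rw [h, zero_mul] at this
    exact absurd (h2 i hi (sub_eq_zero.1 this.symm)) (by decide)
  have hl1 : ∀ i < m, l i - 1 ≠ 0 := fun i hi h => by
    have := hl i hi
    rw [sub_eq_zero.1 h, one_mul] at this
    exact absurd (h2 i hi (sub_left_injective this)) (by decide)
  let w : ℕ → Fin 3 → K × K := fun i a => ptv ω (s i) (t i a)
  let d : ℕ → Fin 3 → F := fun i => ![1, l i, l i - 1]
  have hd : ∀ i < m, ∀ a, d i a ≠ 0 := by
    intro i hi a
    fin_cases a
    · exact one_ne_zero
    · exact hl0 i hi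
    · exact hl1 i hi
  let u₁ : Fin m → Fin 4 → F := fun i => e (l i • w i 1)
  let u₂ : Fin m → Fin 4 → F := fun i => e ((l i - 1) • w i 2)
  have hsub : ∀ i : Fin m, u₁ i - u₂ i = e (w i 0) := by
    intro i
    simp only [u₁, u₂, ← map_sub]
    congr 1
    have := congrArg (algebraMap F K) (hl i i.2)
    simp only [map_sub, map_mul] at this
    refine Prod.ext ?_ ?_
    · simp only [w, ptv, Prod.fst_sub, Prod.smul_fst]
      simp only [Algebra.smul_def, map_sub, map_one]
      linear_combination this
    · simp only [w, ptv, Prod.snd_sub, Prod.smul_snd]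
      simp only [Algebra.smul_def, map_sub, map_one]
      linear_combination s i * this
  have hu : ∀ (i : Fin m) (a : Fin 3),
      ![u₁ i - u₂ i, u₁ i, u₂ i] a = e (d i a • w i a) := by
    intro i a
    rw [hsub]
    fin_cases a
    · simp [d]
    · simp [d, u₁]
    · simp [d, u₂]
  refine ⟨u₁, u₂, ?_, ?_, ?_⟩
  · intro i
    have li : LinearIndependent F ![u₁ i, u₂ i] := by
      rw [LinearIndependent.pair_iff]
      intro a b hab
      simp only [u₁, u₂, ← map_smul, ← map_add, EmbeddingLike.map_eq_zero_iff] at hab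
      have e1 := congrArg Prod.fst hab
      simp only [w, ptv, Prod.fst_add, Prod.smul_fst, Prod.fst_zero] at e1
      simp only [Algebra.smul_def] at e1
      obtain ⟨f1, f2⟩ := hω (a * l i * t i 1 + b * (l i - 1) * t i 2) (a * l i + b * (l i - 1))
        (by simp only [map_add, map_mul]; linear_combination e1)
      have g : a * l i = 0 := by
        apply (mul_eq_zero.1 (_ : a * l i * (t i 1 - t i 2) = 0)).resolve_right (hne i i.2)
        linear_combination f1 - t i 2 * f2
      rw [g, zero_add] at f2
      exact ⟨(mul_eq_zero.1 g).resolve_right (hl0 i i.2),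
        (mul_eq_zero.1 f2).resolve_right (hl1 i i.2)⟩
    have := finrank_span_eq_card li
    have hr : Set.range ![u₁ i, u₂ i] = {u₁ i, u₂ i} := by
      ext x
      simp; tauto
    rw [hr] at this
    exact this
  · intro i j hij
    have hs := h1 i j hij j.2
    have key : ∀ (i : Fin m) x, x ∈ Submodule.span F {u₁ i, u₂ i} →
        (e.symm x).2 = s i * (e.symm x).1 := by
      intro i x hx
      obtain ⟨a, b, rfl⟩ := Submodule.mem_span_pair.1 hx
      simp only [u₁, u₂, ← map_smul, ← map_add, LinearEquiv.symm_apply_apply]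
      simp only [w, ptv, Prod.fst_add, Prod.smul_fst, Prod.snd_add, Prod.smul_snd]
      simp only [Algebra.smul_def]
      ring
    rw [eq_bot_iff]
    rintro x ⟨hx1, hx2⟩
    have k1 := key i x hx1
    have k2 := key j x hx2
    have k : (e.symm x).1 = 0 := by
      apply (mul_eq_zero.1 (_ : (s i - s j) * (e.symm x).1 = 0)).resolve_left (sub_ne_zero.2 hs)
      linear_combination k2 - k1
    rw [k, mul_zero] at k1
    have : e.symm x = 0 := Prod.ext k k1
    simpa using this
  · intro i j k hij hjk a b c
    rw [hu, hu, hu]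
    have li : LinearIndependent F
        ![e (d i a • w i a), e (d j b • w j b), e (d k c • w k c)] := by
      rw [Fintype.linearIndependent_iff]
      intro g hg
      rw [Fin.sum_univ_three] at hg
      simp only [Matrix.cons_val, ← map_smul, ← map_add, EmbeddingLike.map_eq_zero_iff,
        smul_smul] at hg
      obtain ⟨g0, g1, g2⟩ := li3 ω hω _ _ _ _ _ _ (h1 i j hij j.2)
        (h3 i j k hij hjk k.2 a b c) _ _ _ hg
      have g0 := (mul_eq_zero.1 g0).resolve_right (hd i i.2 a)
      have g1 := (mul_eq_zero.1 g1).resolve_right (hd j j.2 b)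
      have g2 := (mul_eq_zero.1 g2).resolve_right (hd k k.2 c)
      intro n
      fin_cases n
      · exact g0
      · exact g1
      · exact g2
    have := finrank_span_eq_card li
    have hr : ∀ x y z : Fin 4 → F, Set.range ![x, y, z] = {x, y, z} := by
      intro x y z
      ext v
      simp; tauto
    rw [hr] at this
    exact this

theorem theorem2_vector_sequences_exist
    (F : Type*) [Field F] [Fintype F] (q : ℕ) (hq : Fintype.card F = q) (hq4 : 4 ≤ q) :
    ∃ L : ℕ, max ⌈(Real.sqrt 2 / 3) * (q : ℝ)⌉ 3 ≤ (L : ℤ) ∧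
      ∃ u₁ u₂ : Fin L → (Fin 4 → F), GoodSeq L u₁ u₂ := by
  obtain ⟨K, _, _, _, hK⟩ := exists_ext F
  obtain ⟨ω, hω⟩ := exists_omega hK
  have hω' : ∀ t : F, algebraMap F K t + ω ≠ 0 := fun t h =>
    one_ne_zero (hω t 1 (by simpa using h)).2
  have hcard : Fintype.card K = q ^ 2 := by
    rw [Module.card_eq_pow_finrank (K := F), hK, hq]
  refine ⟨(max ⌈(Real.sqrt 2 / 3) * (q : ℝ)⌉ 3).toNat, Int.self_le_toNat _, ?_⟩
  obtain ⟨s, t, h1, h2, h3⟩ := seq_lemma ω hω' (hq ▸ hq4)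
    (max ⌈(Real.sqrt 2 / 3) * (q : ℝ)⌉ 3).toNat (by
      intro n hn
      rw [Int.lt_toNat, lt_max_iff] at hn
      rw [hcard]
      have hmain : 9 * n * n < 2 * q ^ 2 + 7 * n := by
        rcases hn with hn | hn
        · rw [Int.lt_ceil] at hn
          push_cast at hn
          have h2 : Real.sqrt 2 ^ 2 = 2 := Real.sq_sqrt (by norm_num)
          have h0 : (0 : ℝ) ≤ n := Nat.cast_nonneg n
          have h9 : (3 * (n : ℝ)) ^ 2 < (Real.sqrt 2 * q) ^ 2 := by
            apply pow_lt_pow_left₀ _ (by positivity) (by norm_num)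
            linarith
          rw [mul_pow, mul_pow, h2] at h9
          have : (3 : ℕ) ^ 2 * n ^ 2 < 2 * q ^ 2 := by exact_mod_cast h9
          nlinarith
        · have : n ≤ 2 := by omega
          have hqq : 16 ≤ q ^ 2 := by nlinarith
          interval_cases n <;> omega
      rcases n with _ | n
      · have : 0 < q ^ 2 := by positivity
        simpa using this
      · rw [Nat.add_sub_cancel]
        have : 9 * (n + 1) * (n + 1) = 9 * ((n + 1) * n) + 9 * (n + 1) := by ring
        omega)
  exact good_of_seq hK ω hω _ s t h1 h2 h3
end

section
/- (Theorem 2, existence of codes) Let q ≥ 4 be a prime power. Then there exist an integer L ≥ max{⌈(√2/3)·q⌉, 3} and a linear code C over F_q with disjoint local repair groups, locality r = 2, length n = 3L ≥ max{3⌈(√2/3)·q⌉, 9}, dimension k = 2L − 4, and minimum distance d ∈ {7, 8}; moreover the dimension attains the bound of Lemma 3, i.e., k = 2n/3 − ⌈log_q( q + q(q−1)(n − 2) )⌉ (equivalently, ⌈log_q( q + q(q−1)(3L − 2) )⌉ = 4). -/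
variable {F : Type*} [Field F] [DecidableEq F] {n : ℕ}

/-- two by two determinant -/
def dt {K : Type*} [Field K] (a b : K × K) : K := a.1 * b.2 - a.2 * b.1

theorem dt_zero {K : Type*} [Field K] {a b v : K × K} (hab : dt a b ≠ 0) (ha : dt a v = 0)
    (hb : dt b v = 0) : v = 0 := by
  unfold dt at *
  have h1 : (a.1 * b.2 - a.2 * b.1) * v.1 = 0 := by
    linear_combination b.1 * ha - a.1 * hb
  have h2 : (a.1 * b.2 - a.2 * b.1) * v.2 = 0 := by
    linear_combination b.2 * ha - a.2 * hb
  exact Prod.ext ((mul_eq_zero.1 h1).resolve_left hab) ((mul_eq_zero.1 h2).resolve_left hab)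

theorem exists_w {K : Type*} [Field K] [Fintype K] :
    ∃ w : ℕ → K × K, ∀ i j, i < Fintype.card K + 1 → j < Fintype.card K + 1 → i ≠ j →
      dt (w i) (w j) ≠ 0 := by
  classical
  let e := Fintype.equivFin K
  refine ⟨fun i => if h : i < Fintype.card K then (1, e.symm ⟨i, h⟩) else (0, 1), ?_⟩
  intro i j hi hj hij
  unfold dt
  by_cases h1 : i < Fintype.card K <;> by_cases h2 : j < Fintype.card K
  · simp only [h1, h2, dif_pos]
    intro h
    have h : e.symm ⟨j, h2⟩ = e.symm ⟨i, h1⟩ := by linear_combination h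
    have := e.symm.injective h
    simp at this
    omega
  · simp [h1, h2]
  · simp [h1, h2]
  · omega

/-- evaluation -/
def Ev {K : Type*} [Field K] (m L : ℕ) (w : ℕ → K × K) :
    (Fin L → K × K) →ₗ[K] (Fin (3 * L) → K) where
  toFun v p := dt (w (p.1 % m)) (v ⟨p.1 / 3, by omega⟩)
  map_add' u v := by ext p; simp [dt]; ring
  map_smul' c v := by ext p; simp [dt]; ring

/-- syndrome -/
def Sy {K : Type*} [Field K] (L : ℕ) (a : Fin L → K) :
    (Fin L → K × K) →ₗ[K] ((K × K) × (K × K)) where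
  toFun v := (∑ i, v i, ∑ i, a i • v i)
  map_add' u v := by simp [Finset.sum_add_distrib]
  map_smul' c v := by
    simp only [Pi.smul_apply, Finset.smul_sum, RingHom.id_apply, Prod.smul_mk]
    congr 1
    exact Finset.sum_congr rfl fun i _ => smul_comm _ _ _

theorem Sy_surj {K : Type*} [Field K] (L : ℕ) (a : Fin L → K) (ha : Function.Injective a)
    (hL : 2 ≤ L) : Function.Surjective (Sy L a) := by
  rintro ⟨x, y⟩
  let i : Fin L := ⟨0, by omega⟩
  let j : Fin L := ⟨1, by omega⟩
  have hij : i ≠ j := by simp [i, j]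
  have hne : a j - a i ≠ 0 := sub_ne_zero.2 (fun h => hij (ha h).symm)
  have key : ∀ u v : K × K, Sy L a (Pi.single i u + Pi.single j v)
      = (u + v, a i • u + a j • v) := by
    intro u v
    have h1 : ∀ (i : Fin L) (u : K × K), Sy L a (Pi.single i u) = (u, a i • u) := by
      intro i u
      have : ∀ k, a k • (Pi.single i u : Fin L → K × K) k
          = (Pi.single i (a i • u) : Fin L → K × K) k := by
        intro k
        by_cases h : k = i
        · subst h; simp
        · simp [h]
      simp only [Sy, LinearMap.coe_mk, AddHom.coe_mk, this]
      simp
    rw [map_add, h1, h1]; rfl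
  refine ⟨Pi.single i (x - (a j - a i)⁻¹ • (y - a i • x))
    + Pi.single j ((a j - a i)⁻¹ • (y - a i • x)), ?_⟩
  rw [key]
  ext
  · simp
  · simp
  · simp; field_simp; ring
  · simp; field_simp; ring

theorem Ev_inj {K : Type*} [Field K] (m L : ℕ) (w : ℕ → K × K) (hm : 3 ≤ m)
    (hw : ∀ i j, i < m → j < m → i ≠ j → dt (w i) (w j) ≠ 0) :
    Function.Injective (Ev m L w) := by
  rw [← LinearMap.ker_eq_bot, LinearMap.ker_eq_bot']
  intro v hv
  ext1 i
  have h0 := congrFun hv ⟨3 * i.1, by omega⟩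
  have h1 := congrFun hv ⟨3 * i.1 + 1, by omega⟩
  have e0 : (3 * i.1) / 3 = i.1 := by omega
  have e1 : (3 * i.1 + 1) / 3 = i.1 := by omega
  simp only [Ev, LinearMap.coe_mk, AddHom.coe_mk, Pi.zero_apply, e0, e1] at h0 h1
  refine dt_zero (hw _ _ (Nat.mod_lt _ (by omega)) (Nat.mod_lt _ (by omega)) ?_) h0 h1
  intro h
  have : 3 * i.1 ≡ 3 * i.1 + 1 [MOD m] := h
  have := (Nat.modEq_iff_dvd' (by omega)).1 this
  have := Nat.le_of_dvd (by omega) this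
  omega

theorem mod_ne {m x y : ℕ} (hm : 3 ≤ m) (h1 : x < y) (h2 : y < x + 3) : x % m ≠ y % m := by
  intro h
  have h : x ≡ y [MOD m] := h
  have := (Nat.modEq_iff_dvd' (by omega)).1 h
  have := Nat.le_of_dvd (by omega) this
  omega

/-- the code -/
def Co {K : Type*} [Field K] (m L : ℕ) (w : ℕ → K × K) (a : Fin L → K) :
    Submodule K (Fin (3 * L) → K) := (LinearMap.ker (Sy L a)).map (Ev m L w)

theorem Co_rank {K : Type*} [Field K] (m L : ℕ) (w : ℕ → K × K) (a : Fin L → K) (hm : 3 ≤ m)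
    (hw : ∀ i j, i < m → j < m → i ≠ j → dt (w i) (w j) ≠ 0) (ha : Function.Injective a)
    (hL : 2 ≤ L) : Module.finrank K (Co m L w a) = 2 * L - 4 := by
  unfold Co
  rw [← (Submodule.equivMapOfInjective _ (Ev_inj m L w hm hw) _).finrank_eq]
  have h := LinearMap.finrank_range_add_finrank_ker (Sy L a)
  rw [LinearMap.range_eq_top.2 (Sy_surj L a ha hL)] at h
  rw [Module.finrank_pi_fintype] at h
  simp at h
  omega

theorem fiber_eq (L : ℕ) (i : Fin L) : (Finset.univ.filter fun p : Fin (3 * L) => p.1 / 3 = i.1)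
    = {⟨3 * i.1, by omega⟩, ⟨3 * i.1 + 1, by omega⟩, ⟨3 * i.1 + 2, by omega⟩} := by
  ext p
  simp only [Finset.mem_filter, Finset.mem_univ, true_and, Finset.mem_insert,
    Finset.mem_singleton, Fin.ext_iff]
  omega

theorem fiber_card (L : ℕ) (i : Fin L) :
    (Finset.univ.filter fun p : Fin (3 * L) => p.1 / 3 = i.1).card = 3 := by
  rw [fiber_eq, Finset.card_eq_three]
  exact ⟨_, _, _, by simp, by simp, by simp, rfl⟩

theorem dt_smul {K : Type*} [Field K] (u v : K × K) (c : K) : dt u (c • v) = c * dt u v := by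
  simp [dt]; ring

theorem Ev_apply {K : Type*} [Field K] (m L : ℕ) (w : ℕ → K × K) (v : Fin L → K × K)
    (p : Fin (3 * L)) : Ev m L w v p = dt (w (p.1 % m)) (v ⟨p.1 / 3, by omega⟩) := rfl

theorem wt_lower {K : Type*} [Field K] [DecidableEq K] (m L : ℕ) (w : ℕ → K × K) (a : Fin L → K)
    (hm : 3 ≤ m) (hmL : 3 * L ≤ 2 * m)
    (hw : ∀ i j, i < m → j < m → i ≠ j → dt (w i) (w j) ≠ 0) (ha : Function.Injective a)
    (v : Fin L → K × K) (hv : Sy L a v = 0) (hv0 : v ≠ 0) : 7 ≤ wt (Ev m L w v) := by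
  classical
  have hs1 : ∑ i, v i = 0 := congrArg Prod.fst hv
  have hs2 : ∑ i, a i • v i = 0 := congrArg Prod.snd hv
  set T := Finset.univ.filter fun i => v i ≠ 0 with hT
  have memT : ∀ i, i ∈ T ↔ v i ≠ 0 := by simp [hT]
  have ht1 : ∑ i ∈ T, v i = 0 := by
    rw [← hs1]; exact Finset.sum_subset (Finset.subset_univ _) (by intro i _ h; simpa [hT] using h)
  have ht2 : ∑ i ∈ T, a i • v i = 0 := by
    rw [← hs2]
    refine Finset.sum_subset (Finset.subset_univ _) ?_
    intro i _ h
    have : v i = 0 := by simpa [hT] using h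
    simp [this]
  let r : Fin (3 * L) → Fin L := fun p => ⟨p.1 / 3, by omega⟩
  set A := Finset.univ.filter fun p => v (r p) ≠ 0 with hA
  have hAc : A.card = 3 * T.card := by
    rw [Finset.card_eq_sum_card_fiberwise (f := r) (t := T)]
    · rw [Finset.sum_congr rfl (g := fun _ => 3)]
      · simp [mul_comm]
      · intro i hi
        refine Eq.trans (congrArg Finset.card ?_) (fiber_card L i)
        ext p
        simp only [hA, Finset.mem_filter, Finset.mem_univ, true_and]
        constructor
        · rintro ⟨_, h⟩; rw [← h]
        · intro h
          have h : r p = i := Fin.ext h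
          rw [h]; exact ⟨(memT i).1 hi, rfl⟩
    · intro p hp
      have := (Finset.mem_filter.1 hp).2
      exact (memT _).2 this
  set Z := A.filter (fun p => Ev m L w v p = 0) with hZ
  have hsplit : A.card ≤ Z.card + wt (Ev m L w v) := by
    rw [← Finset.card_filter_add_card_filter_not (s := A) (fun p => Ev m L w v p = 0)]
    refine Nat.add_le_add_left (Finset.card_le_card ?_) _
    intro p hp
    simpa using (Finset.mem_filter.1 hp).2
  have memZ : ∀ p ∈ Z, v (r p) ≠ 0 ∧ dt (w (p.1 % m)) (v (r p)) = 0 := by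
    intro p hp
    have h := Finset.mem_filter.1 hp
    exact ⟨(Finset.mem_filter.1 h.1).2, h.2⟩
  have hZT : Z.card ≤ T.card := by
    refine Finset.card_le_card_of_injOn r (fun p hp => (memT _).2 (memZ p hp).1) ?_
    intro p hp p' hp' h
    by_contra hne
    have hlt : ∀ p p' : Fin (3 * L), p ∈ Z → p' ∈ Z → r p = r p' → p.1 < p'.1 → False := by
      intro p p' hp hp' h hlt
      have hh : p.1 / 3 = p'.1 / 3 := congrArg Fin.val h
      have h2 := (memZ p' hp').2
      rw [← h] at h2
      exact (memZ p hp).1 (dt_zero (hw _ _ (Nat.mod_lt _ (by omega)) (Nat.mod_lt _ (by omega))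
        (mod_ne hm hlt (by omega))) (memZ p hp).2 h2)
    rcases lt_or_gt_of_ne (fun e => hne (Fin.ext e)) with h' | h'
    · exact hlt p p' hp hp' h h'
    · exact hlt p' p hp' hp h.symm h'
  by_cases h4 : 4 ≤ T.card
  · omega
  have hcard : T.card = 0 ∨ T.card = 1 ∨ T.card = 2 ∨ T.card = 3 := by omega
  rcases hcard with h | h | h | h
  · exfalso; apply hv0
    ext1 i
    by_contra hi
    have := (memT i).2 hi
    rw [Finset.card_eq_zero.1 h] at this
    simp at this
  · exfalso
    obtain ⟨i, hi⟩ := Finset.card_eq_one.1 h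
    rw [hi] at ht1
    simp at ht1
    exact (memT i).1 (by simp [hi]) ht1
  · exfalso
    obtain ⟨i, j, hij, hi⟩ := Finset.card_eq_two.1 h
    rw [hi, Finset.sum_pair hij] at ht1 ht2
    have : (a i - a j) • v i = 0 := by
      have e : v j = - v i := by rw [eq_neg_iff_add_eq_zero, add_comm]; exact ht1
      rw [e] at ht2
      rw [sub_smul, ← ht2]; module
    rcases smul_eq_zero.1 this with h' | h'
    · exact hij (ha (sub_eq_zero.1 h'))
    · exact (memT i).1 (by simp [hi]) h'
  · obtain ⟨i, j, k, hij, hik, hjk, hi⟩ := Finset.card_eq_three.1 h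
    have s3 : ∀ f : Fin L → K × K, ∑ x ∈ T, f x = f i + f j + f k := by
      intro f
      rw [hi, Finset.sum_insert (by simp [hij, hik]), Finset.sum_pair hjk, add_assoc]
    rw [s3] at ht1 ht2
    have n1 : a j - a k ≠ 0 := sub_ne_zero.2 (fun h => hjk (ha h))
    have n2 : a i - a k ≠ 0 := sub_ne_zero.2 (fun h => hik (ha h))
    have n3 : a i - a j ≠ 0 := sub_ne_zero.2 (fun h => hij (ha h))
    have ek : v k = - (v i + v j) := by rw [eq_neg_iff_add_eq_zero, add_comm]; exact ht1
    have ej : (a j - a k) • v j = -((a i - a k) • v i) := by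
      rw [ek] at ht2
      rw [eq_neg_iff_add_eq_zero, ← ht2]; module
    have prop : ∀ u : K × K, ∀ x ∈ T, dt u (v x) = 0 → dt u (v i) = 0 := by
      intro u x hx hu
      have ejd : (a j - a k) * dt u (v j) = -((a i - a k) * dt u (v i)) := by
        rw [← dt_smul, ej, ← neg_smul, dt_smul]; ring
      have ekd : dt u (v k) = - (dt u (v i) + dt u (v j)) := by rw [ek]; simp [dt]; ring
      rw [hi] at hx
      simp only [Finset.mem_insert, Finset.mem_singleton] at hx
      rcases hx with rfl | rfl | rfl
      · exact hu
      · rw [hu] at ejd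
        have : (a i - a k) * dt u (v i) = 0 := by linear_combination ejd
        exact (mul_eq_zero.1 this).resolve_left n2
      · rw [hu] at ekd
        have : (a i - a j) * dt u (v i) = 0 := by linear_combination ejd - (a j - a x) * ekd
        exact (mul_eq_zero.1 this).resolve_left n3
    have hvi : v i ≠ 0 := (memT i).1 (by simp [hi])
    have hmod : ∀ p ∈ Z, ∀ p' ∈ Z, p.1 % m = p'.1 % m := by
      intro p hp p' hp'
      by_contra hne
      refine hvi (dt_zero (hw _ _ (Nat.mod_lt _ (by omega)) (Nat.mod_lt _ (by omega)) hne)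
        (prop _ _ ((memT _).2 (memZ p hp).1) (memZ p hp).2)
        (prop _ _ ((memT _).2 (memZ p' hp').1) (memZ p' hp').2))
    have hZ2 : Z.card ≤ (Finset.range 2).card := by
      refine Finset.card_le_card_of_injOn (fun p => p.1 / m) ?_ ?_
      · intro p hp
        simp only [Finset.coe_range, Set.mem_Iio]
        rw [Nat.div_lt_iff_lt_mul (by omega)]
        omega
      · intro p hp p' hp' h
        have h : p.1 / m = p'.1 / m := h
        apply Fin.ext
        rw [← Nat.div_add_mod p.1 m, ← Nat.div_add_mod p'.1 m, h, hmod p hp p' hp']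
    simp at hZ2
    omega

theorem wt_upper {K : Type*} [Field K] [DecidableEq K] (m L : ℕ) (w : ℕ → K × K) (a : Fin L → K)
    (hL : 3 ≤ L) (hw0 : w 0 ≠ 0) (ha : Function.Injective a) :
    ∃ v : Fin L → K × K, Sy L a v = 0 ∧ v ≠ 0 ∧ wt (Ev m L w v) ≤ 8 := by
  let i : Fin L := ⟨0, by omega⟩
  let j : Fin L := ⟨1, by omega⟩
  let k : Fin L := ⟨2, by omega⟩
  have hij : i ≠ j := by simp [i, j]
  have hik : i ≠ k := by simp [i, k]
  have hjk : j ≠ k := by simp [j, k]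
  let c : Fin L → K := fun x => if x = i then a j - a k else if x = j then a k - a i else
    if x = k then a i - a j else 0
  have ci : c i = a j - a k := by simp [c]
  have cj : c j = a k - a i := by simp [c, hij.symm]
  have ck : c k = a i - a j := by simp [c, hik.symm, hjk.symm]
  have c0 : ∀ x, 2 < x.1 → c x = 0 := by
    intro x hx
    simp only [c, i, j, k, Fin.ext_iff]
    rw [if_neg (by omega), if_neg (by omega), if_neg (by omega)]
  have s3 : ∀ f : Fin L → K × K, (∀ x, 2 < x.1 → f x = 0) → ∑ x, f x = f i + (f j + f k) := by
    intro f hf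
    rw [← Finset.sum_subset (Finset.subset_univ {i, j, k}),
      Finset.sum_insert (by simp [hij, hik]), Finset.sum_pair hjk]
    intro x _ hx
    apply hf
    simp [i, j, k, Fin.ext_iff] at hx
    omega
  refine ⟨fun x => c x • w 0, ?_, ?_, ?_⟩
  · have h1 : ∑ x, c x • w 0 = 0 := by
      rw [s3 _ (fun x hx => by rw [c0 x hx, zero_smul]), ci, cj, ck]; module
    have h2 : ∑ x, a x • c x • w 0 = 0 := by
      rw [s3 _ (fun x hx => by rw [c0 x hx, zero_smul, smul_zero]), ci, cj, ck]; module
    exact Prod.ext h1 h2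
  · intro h
    have := congrFun h i
    simp only [ci, Pi.zero_apply, smul_eq_zero] at this
    rcases this with h | h
    · exact hjk (ha (sub_eq_zero.1 h))
    · exact hw0 h
  · unfold wt
    have : (8 : ℕ) = (Finset.Ico 1 9).card := by simp
    rw [this]
    refine Finset.card_le_card_of_injOn (fun p => p.1) ?_ (fun p _ p' _ h => Fin.ext h)
    intro p hp
    have hp := (Finset.mem_filter.1 hp).2
    rw [Ev_apply] at hp
    simp only [Finset.coe_Ico, Set.mem_Ico]
    constructor
    · by_contra hlt
      apply hp
      have : p.1 = 0 := by omega
      have hm0 : p.1 % m = 0 := by rw [this, Nat.zero_mod]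
      rw [dt_smul, hm0]
      simp [dt, mul_comm]
    · by_contra hge
      apply hp
      rw [c0 _ (by simp; omega)]
      simp [dt]

theorem Co_lrg {K : Type*} [Field K] [DecidableEq K] (m L : ℕ) (w : ℕ → K × K) (a : Fin L → K)
    (hm : 3 ≤ m) (hw : ∀ i j, i < m → j < m → i ≠ j → dt (w i) (w j) ≠ 0) :
    HasDisjointLRG (Co m L w a) 2 := by
  classical
  refine ⟨Finset.univ.image fun i : Fin L =>
    (Finset.univ.filter fun p : Fin (3 * L) => p.1 / 3 = i.1), ?_, ?_, ?_⟩
  · intro G hG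
    obtain ⟨i, _, rfl⟩ := Finset.mem_image.1 hG
    exact fiber_card L i
  · intro p
    refine ⟨Finset.univ.filter fun p' : Fin (3 * L) => p'.1 / 3 = p.1 / 3, ⟨?_, by simp⟩, ?_⟩
    · exact Finset.mem_image.2 ⟨⟨p.1 / 3, by omega⟩, Finset.mem_univ _, rfl⟩
    · rintro G ⟨hG, hp⟩
      obtain ⟨i, _, rfl⟩ := Finset.mem_image.1 hG
      have := (Finset.mem_filter.1 hp).2
      rw [this]
  · intro G hG
    obtain ⟨i, _, rfl⟩ := Finset.mem_image.1 hG
    let p0 : Fin (3 * L) := ⟨3 * i.1, by omega⟩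
    let p1 : Fin (3 * L) := ⟨3 * i.1 + 1, by omega⟩
    let p2 : Fin (3 * L) := ⟨3 * i.1 + 2, by omega⟩
    have h01 : p0 ≠ p1 := by simp [p0, p1]
    have h02 : p0 ≠ p2 := by simp [p0, p2]
    have h12 : p1 ≠ p2 := by simp [p1, p2]
    let u0 := w ((3 * i.1) % m)
    let u1 := w ((3 * i.1 + 1) % m)
    let u2 := w ((3 * i.1 + 2) % m)
    have d12 : dt u1 u2 ≠ 0 := hw _ _ (Nat.mod_lt _ (by omega)) (Nat.mod_lt _ (by omega))
      (mod_ne hm (by omega) (by omega))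
    have d20 : dt u2 u0 ≠ 0 := hw _ _ (Nat.mod_lt _ (by omega)) (Nat.mod_lt _ (by omega))
      (mod_ne hm (by omega) (by omega)).symm
    have d01 : dt u0 u1 ≠ 0 := hw _ _ (Nat.mod_lt _ (by omega)) (Nat.mod_lt _ (by omega))
      (mod_ne hm (by omega) (by omega))
    let y : Fin (3 * L) → K := fun p => if p = p0 then dt u1 u2 else if p = p1 then dt u2 u0 else
      if p = p2 then dt u0 u1 else 0
    have y0 : y p0 = dt u1 u2 := by simp [y]
    have y1 : y p1 = dt u2 u0 := by simp [y, h01.symm]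
    have y2 : y p2 = dt u0 u1 := by simp [y, h02.symm, h12.symm]
    have yn : ∀ p, p ∉ ({p0, p1, p2} : Finset (Fin (3 * L))) → y p = 0 := by
      intro p hp
      simp only [Finset.mem_insert, Finset.mem_singleton, not_or] at hp
      simp [y, hp]
    refine ⟨y, ?_, ?_⟩
    · intro x hx
      obtain ⟨v, _, rfl⟩ := hx
      rw [← Finset.sum_subset (Finset.subset_univ {p0, p1, p2}),
        Finset.sum_insert (by simp [h01, h02]), Finset.sum_pair h12, y0, y1, y2,
        Ev_apply, Ev_apply, Ev_apply]
      · have e0 : (3 * i.1) / 3 = i.1 := by omega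
        have e1 : (3 * i.1 + 1) / 3 = i.1 := by omega
        have e2 : (3 * i.1 + 2) / 3 = i.1 := by omega
        simp only [p0, p1, p2, e0, e1, e2, Fin.eta]
        change dt u0 (v i) * dt u1 u2 + (dt u1 (v i) * dt u2 u0 + dt u2 (v i) * dt u0 u1) = 0
        simp only [dt]; ring
      · intro p _ hp
        rw [yn p hp, mul_zero]
    · intro p
      rw [fiber_eq]
      constructor
      · intro h
        by_contra hp
        exact h (yn p hp)
      · intro h
        simp only [Finset.mem_insert, Finset.mem_singleton] at h
        rcases h with rfl | rfl | rfl
        · exact y0 ▸ d12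
        · exact y1 ▸ d20
        · exact y2 ▸ d01

theorem loc_of_lrg {K : Type*} [Field K] [DecidableEq K] {N r : ℕ} (C : Submodule K (Fin N → K))
    (h : HasDisjointLRG C r) : HasLocality C r := by
  obtain ⟨P, h1, h2, h3⟩ := h
  intro i
  obtain ⟨G, ⟨hG, hi⟩, _⟩ := h2 i
  obtain ⟨c, hc, hs⟩ := h3 G hG
  refine ⟨c, hc, ?_, (hs i).2 hi⟩
  rw [← h1 G hG]
  unfold wt
  exact Finset.card_le_card (fun p hp => (hs p).1 (Finset.mem_filter.1 hp).2)

/-- **Theorem 2, existence of codes.** Let `q ≥ 4` be a prime power (the cardinality of a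
finite field `F`). Then there exist an integer `L ≥ max{⌈(√2/3)·q⌉, 3}` and a linear code
`C` over `F` with disjoint local repair groups, locality `r = 2`, length `n = 3L`,
dimension `k = 2L − 4`, and minimum distance `d ∈ {7, 8}`; moreover the dimension attains
the bound of Lemma 3, i.e. `⌈log_q( q + q(q−1)(3L − 2) )⌉ = 4` (so that
`k = 2n/3 − ⌈log_q( q + q(q−1)(n − 2) )⌉`). -/
theorem theorem2_codes_exist
    (F : Type*) [Field F] [Fintype F] [DecidableEq F]
    (q : ℕ) (hq : Fintype.card F = q) (hq4 : 4 ≤ q) :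
    ∃ L : ℕ, max ⌈(Real.sqrt 2 / 3) * (q : ℝ)⌉ 3 ≤ (L : ℤ) ∧
      ∃ C : Submodule F (Fin (3 * L) → F),
        Module.finrank F C = 2 * L - 4 ∧
        (∃ d : ℕ, IsMinDist C d ∧ (d = 7 ∨ d = 8)) ∧
        HasLocality C 2 ∧
        HasDisjointLRG C 2 ∧
        Nat.clog q (q + q * (q - 1) * (3 * L - 2)) = 4 := by
  classical
  have hqL1 : 3 * (2 * (q + 1) / 3) ≤ 2 * (q + 1) := by omega
  have hqL2 : 2 * q ≤ 3 * (2 * (q + 1) / 3) := by omega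
  generalize 2 * (q + 1) / 3 = L at hqL1 hqL2
  have hL3 : 3 ≤ L := by omega
  obtain ⟨w, hw⟩ := exists_w (K := F)
  rw [hq] at hw
  let a : Fin L → F := fun i => (Fintype.equivFin F).symm ⟨i.1, by omega⟩
  have ha : Function.Injective a := by
    intro i j h
    have := (Fintype.equivFin F).symm.injective h
    simp at this
    exact Fin.ext this
  have hm : 3 ≤ q + 1 := by omega
  have hw0 : w 0 ≠ 0 := by
    intro h
    apply hw 0 1 (by omega) (by omega) (by omega)
    simp [h, dt]
  have hinj := Ev_inj (q + 1) L w hm hw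
  have hlrg := Co_lrg (q + 1) L w a hm hw
  refine ⟨L, ?_, Co (q + 1) L w a, Co_rank _ _ _ _ hm hw ha (by omega), ?_, loc_of_lrg _ hlrg,
    hlrg, ?_⟩
  · refine max_le ?_ (by exact_mod_cast hL3)
    rw [Int.ceil_le]
    have h2 : Real.sqrt 2 ≤ 2 := by
      rw [Real.sqrt_le_left (by norm_num)]; norm_num
    have h3 : (2 : ℝ) * q ≤ 3 * L := by exact_mod_cast hqL2
    have h4 : Real.sqrt 2 * q ≤ 2 * q := by gcongr
    push_cast
    linarith
  · have hlow : ∀ c ∈ Co (q + 1) L w a, c ≠ 0 → 7 ≤ wt c := by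
      rintro c ⟨v, hv, rfl⟩ hc
      refine wt_lower _ _ _ a hm hqL1 hw ha v hv ?_
      rintro rfl
      exact hc (map_zero _)
    obtain ⟨v, hv, hv0, hv8⟩ := wt_upper (q + 1) L w a hL3 hw0 ha
    have hvC : Ev (q + 1) L w v ∈ Co (q + 1) L w a := ⟨v, hv, rfl⟩
    have hvn : Ev (q + 1) L w v ≠ 0 := fun h => hv0 (hinj (h.trans (map_zero _).symm))
    have hv7 := hlow _ hvC hvn
    by_cases hex : ∃ c ∈ Co (q + 1) L w a, c ≠ 0 ∧ wt c = 7
    · exact ⟨7, ⟨hex, hlow⟩, Or.inl rfl⟩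
    · have h8 : ∀ c ∈ Co (q + 1) L w a, c ≠ 0 → 8 ≤ wt c := by
        intro c hc hc0
        have := hlow c hc hc0
        have : wt c ≠ 7 := fun h => hex ⟨c, hc, hc0, h⟩
        omega
      have := h8 _ hvC hvn
      exact ⟨8, ⟨⟨_, hvC, hvn, by omega⟩, h8⟩, Or.inr rfl⟩
  · obtain ⟨t, rfl⟩ : ∃ t, q = t + 1 := ⟨q - 1, by omega⟩
    obtain ⟨s, hs⟩ : ∃ s, 3 * L = s + 2 := ⟨3 * L - 2, by omega⟩
    rw [hs, Nat.add_sub_cancel, Nat.add_sub_cancel]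
    have hs1 : t + 3 ≤ s := by omega
    have hs2 : s ≤ 2 * t + 2 := by omega
    have ht : 3 ≤ t := by omega
    apply le_antisymm
    · rw [Nat.clog_le_iff_le_pow (by omega)]
      have : 1 + t * s ≤ (t + 1) ^ 3 := by
        have : t * s ≤ t * (2 * t + 2) := Nat.mul_le_mul_left _ hs2
        nlinarith [Nat.zero_le (t ^ 3), Nat.zero_le (t ^ 2)]
      calc _ = (t + 1) * (1 + t * s) := by ring
        _ ≤ (t + 1) * (t + 1) ^ 3 := Nat.mul_le_mul_left _ this
        _ = _ := by ring
    · apply Nat.succ_le_of_lt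
      rw [Nat.lt_clog_iff_pow_lt (by omega)]
      have : (t + 1) ^ 2 < 1 + t * s := by
        have : t * (t + 3) ≤ t * s := Nat.mul_le_mul_left _ hs1
        nlinarith
      calc _ = (t + 1) * (t + 1) ^ 2 := by ring
        _ < (t + 1) * (1 + t * s) := Nat.mul_lt_mul_of_pos_left this (by omega)
        _ = _ := by ring
end
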